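/- arXiv:2306.00524 — 3 statements merged into one kernel-verified Lean document; each statement's English description precedes it below -/
import Mathlib

section
/- Let f be a homeomorphism of a compact metric space X, let λ>1, and let D':E→ℝ satisfy 0≤D'(C_(p,q))≤1 for all C_(p,q)∈E. Suppose there exists δ>0 such that D'(C_(p,q))≤δ implies max{D'(f(C_(p,q))), D'(f⁻¹(C_(p,q)))} ≥ λ·D'(C_(p,q)). Define D:E→ℝ by D(C_(p,q)) = sup_{i∈ℤ} D'(f^i(C_(p,q)))/λ^{|i|} (this supremum is finite, bounded by 1). Then D'≤D, and whenever D(C_(p,q))≤δ one has max{D(f(C_(p,q))), D(f⁻¹(C_(p,q)))} = λ·D(C_(p,q)). -/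
open Metric Set Filter Topology

namespace CwDyn

variable {X : Type*} [MetricSpace X]

/-- The ε-stable set of `x`. -/
def Ws (f : X ≃ₜ X) (ε : ℝ) (x : X) : Set X :=
  {y | ∀ n : ℕ, dist ((⇑f)^[n] x) ((⇑f)^[n] y) ≤ ε}

/-- The ε-unstable set of `x`. -/
def Wu (f : X ≃ₜ X) (ε : ℝ) (x : X) : Set X :=
  {y | ∀ n : ℕ, dist ((⇑f.symm)^[n] x) ((⇑f.symm)^[n] y) ≤ ε}

/-- The connected component of `x` in its ε-stable set. -/
def Cs (f : X ≃ₜ X) (ε : ℝ) (x : X) : Set X := connectedComponentIn (Ws f ε x) x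

/-- The connected component of `x` in its ε-unstable set. -/
def Cu (f : X ≃ₜ X) (ε : ℝ) (x : X) : Set X := connectedComponentIn (Wu f ε x) x

/-- `c` is a cw-expansive constant for `f`. -/
def CwExpansiveConst (f : X ≃ₜ X) (c : ℝ) : Prop :=
  0 < c ∧ ∀ x : X, IsTotallyDisconnected (Ws f c x ∩ Wu f c x)

/-- The cw-local-product-structure. -/
def CwLocalProduct (f : X ≃ₜ X) : Prop :=
  ∀ ε : ℝ, 0 < ε → ∃ δ : ℝ, 0 < δ ∧
    ∀ x y : X, dist x y < δ → (Cs f ε x ∩ Cu f ε y).Nonempty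

/-- `f` is cw-hyperbolic: cw-expansive with the cw-local-product-structure. -/
def CwHyperbolic (f : X ≃ₜ X) : Prop :=
  (∃ c : ℝ, CwExpansiveConst f c) ∧ CwLocalProduct f

/-- A subcontinuum: a nonempty compact connected subset. -/
def Subcontinuum (C : Set X) : Prop := IsCompact C ∧ IsConnected C

/-- `D` is a hyperbolic cw-metric for `f`, viewed as a function of triples `(p, q, C)`
with `C` a subcontinuum and `p, q ∈ C`. -/
structure IsHypCwMetric (f : X ≃ₜ X) (D : X → X → Set X → ℝ) : Prop where
  nonneg : ∀ (C : Set X) (p q : X), Subcontinuum C → p ∈ C → q ∈ C → 0 ≤ D p q C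
  eq_zero_iff : ∀ (C : Set X) (p q : X), Subcontinuum C → p ∈ C → q ∈ C →
    (D p q C = 0 ↔ ∃ z : X, C = {z})
  symm : ∀ (C : Set X) (p q : X), Subcontinuum C → p ∈ C → q ∈ C → D p q C = D q p C
  triangle : ∀ (A B : Set X) (a b c : X), Subcontinuum A → Subcontinuum B →
    a ∈ A → b ∈ A → b ∈ B → c ∈ B → D a c (A ∪ B) ≤ D a b A + D b c B
  hyperbolic : ∃ lam : ℝ, lam ∈ Set.Ioo (0 : ℝ) 1 ∧ ∃ ε₀ : ℝ, 0 < ε₀ ∧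
    (∀ (C : Set X) (p q : X), Subcontinuum C → p ∈ C → q ∈ C →
      (∀ n : ℕ, diam ((⇑f)^[n] '' C) ≤ ε₀) →
      ∀ n : ℕ, D ((⇑f)^[n] p) ((⇑f)^[n] q) ((⇑f)^[n] '' C) ≤ 4 * lam ^ n * D p q C) ∧
    (∀ (C : Set X) (p q : X), Subcontinuum C → p ∈ C → q ∈ C →
      (∀ n : ℕ, diam ((⇑f.symm)^[n] '' C) ≤ ε₀) →
      ∀ n : ℕ, D ((⇑f.symm)^[n] p) ((⇑f.symm)^[n] q) ((⇑f.symm)^[n] '' C) ≤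
        4 * lam ^ n * D p q C)
  compat : ∀ δ : ℝ, 0 < δ → ∃ γ : ℝ, 0 < γ ∧
    (∀ (C : Set X) (p q : X), Subcontinuum C → p ∈ C → q ∈ C → diam C < γ → D p q C < δ) ∧
    (∀ (C : Set X) (p q : X), Subcontinuum C → p ∈ C → q ∈ C → D p q C < γ → diam C < δ)

/-- A hyperbolic cw-metric `D` is self-similar with constants `ξ` and `lam`. -/
def SelfSimilarWith (f : X ≃ₜ X) (D : X → X → Set X → ℝ) (ξ lam : ℝ) : Prop :=
  ∀ (C : Set X) (p q : X), Subcontinuum C → p ∈ C → q ∈ C → D p q C ≤ ξ →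
    max (D (f p) (f q) (⇑f '' C)) (D (f.symm p) (f.symm q) (⇑f.symm '' C)) = lam * D p q C

/-- `f` has continuous joint stable/unstable holonomies with respect to `D`
(for the fixed constants `ε` and `δ`); the membership `pstar ∈ Cu f ε p ∩ Cs f ε y`
says exactly that `pstar ∈ π^s_{x,y}(p)`. -/
def ContJointHolonomies (f : X ≃ₜ X) (D : X → X → Set X → ℝ) (ε δ : ℝ) : Prop :=
  ∀ η : ℝ, 0 < η → ∃ γ : ℝ, 0 < γ ∧
    ∀ (x y p q pstar : X) (C C' : Set X),
      dist x y < δ →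
      Subcontinuum C → C ⊆ Cs f ε x → p ∈ C → q ∈ C → D p q C ≤ γ →
      pstar ∈ Cu f ε p ∩ Cs f ε y →
      Subcontinuum C' → C' ⊆ Cu f ε p → p ∈ C' → pstar ∈ C' → D p pstar C' ≤ γ →
      ∃ (Cst Cuu : Set X) (qstar : X),
        Subcontinuum Cst ∧ Cst ⊆ Cs f ε y ∧ pstar ∈ Cst ∧
        Subcontinuum Cuu ∧ Cuu ⊆ Cu f ε q ∧ q ∈ Cuu ∧
        qstar ∈ Cst ∩ Cuu ∧
        D pstar qstar Cst ≤ η ∧ D q qstar Cuu ≤ η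

/-- `f` has pseudo-isometric joint stable/unstable holonomies with respect to `D`. -/
def PseudoIsomJointHolonomies (f : X ≃ₜ X) (D : X → X → Set X → ℝ) (ε δ : ℝ) : Prop :=
  ∀ η : ℝ, 0 < η → ∃ γ : ℝ, 0 < γ ∧
    ∀ (x y p q pstar : X) (C C' : Set X),
      dist x y < δ →
      Subcontinuum C → C ⊆ Cs f ε x → p ∈ C → q ∈ C → D p q C ≤ γ →
      pstar ∈ Cu f ε p ∩ Cs f ε y →
      Subcontinuum C' → C' ⊆ Cu f ε p → p ∈ C' → pstar ∈ C' → D p pstar C' ≤ γ →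
      ∃ (Cst Cuu : Set X) (qstar : X),
        Subcontinuum Cst ∧ Cst ⊆ Cs f ε y ∧ pstar ∈ Cst ∧
        Subcontinuum Cuu ∧ Cuu ⊆ Cu f ε q ∧ q ∈ Cuu ∧
        qstar ∈ Cst ∩ Cuu ∧
        |D pstar qstar Cst / D p q C - 1| ≤ η ∧ |D q qstar Cuu / D p pstar C' - 1| ≤ η

/-- All local stable holonomies of `f` are isometric with respect to `D`. -/
def IsomStableHolonomies (f : X ≃ₜ X) (D : X → X → Set X → ℝ) (ε δ : ℝ) : Prop :=
  ∀ x y : X, dist x y < δ →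
    ∀ (C : Set X) (p q : X), Subcontinuum C → C ⊆ Cs f δ x → p ∈ C → q ∈ C →
      ∃ (Cst : Set X) (pstar qstar : X),
        Subcontinuum Cst ∧ Cst ⊆ Cs f ε y ∧
        pstar ∈ Cu f ε p ∩ Cs f ε y ∧ pstar ∈ Cst ∧
        qstar ∈ Cu f ε q ∩ Cs f ε y ∧ qstar ∈ Cst ∧
        D pstar qstar Cst = D p q C

/-- All local unstable holonomies of `f` are isometric with respect to `D`. -/
def IsomUnstableHolonomies (f : X ≃ₜ X) (D : X → X → Set X → ℝ) (ε δ : ℝ) : Prop :=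
  ∀ x y : X, dist x y < δ →
    ∀ (C : Set X) (p q : X), Subcontinuum C → C ⊆ Cu f δ x → p ∈ C → q ∈ C →
      ∃ (Cst : Set X) (pstar qstar : X),
        Subcontinuum Cst ∧ Cst ⊆ Cu f ε y ∧
        pstar ∈ Cs f ε p ∩ Cu f ε y ∧ pstar ∈ Cst ∧
        qstar ∈ Cs f ε q ∩ Cu f ε y ∧ qstar ∈ Cst ∧
        D pstar qstar Cst = D p q C

/-- The set of periodic points of `g`. -/
def Per (g : X → X) : Set X := {x | ∃ k : ℕ, 1 ≤ k ∧ g^[k] x = x}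

/-- The set of non-wandering points of `g`. -/
def Omega (g : X → X) : Set X :=
  {x | ∀ U ∈ 𝓝 x, ∃ k : ℕ, 1 ≤ k ∧ (g^[k] '' U ∩ U).Nonempty}

/-- Topological transitivity. -/
def TopTransitive (g : X → X) : Prop :=
  ∀ U V : Set X, IsOpen U → IsOpen V → U.Nonempty → V.Nonempty →
    ∃ n : ℕ, (g^[n] '' U ∩ V).Nonempty

/-- There is a finite ε-pseudo-orbit from `x` to `y` (of length at least one). -/
def PseudoOrbit (g : X → X) (ε : ℝ) (x y : X) : Prop :=
  ∃ (m : ℕ) (σ : ℕ → X), 1 ≤ m ∧ σ 0 = x ∧ σ m = y ∧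
    ∀ k < m, dist (g (σ k)) (σ (k + 1)) ≤ ε

/-- `x` is a chain recurrent point of `g`. -/
def ChainRecurrent (g : X → X) (x : X) : Prop := ∀ ε : ℝ, 0 < ε → PseudoOrbit g ε x x

/-- The chain-recurrent class of `x`. -/
def ChainClass (g : X → X) (x : X) : Set X :=
  {y | ChainRecurrent g y ∧ ∀ ε : ℝ, 0 < ε → PseudoOrbit g ε x y ∧ PseudoOrbit g ε y x}

/-- `C` is a chain-recurrent class of `g`. -/
def IsChainClass (g : X → X) (C : Set X) : Prop :=
  ∃ x : X, ChainRecurrent g x ∧ C = ChainClass g x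

/-- The stable set of a set `C`: points whose forward orbit converges to `C`. -/
def Wstab (g : X → X) (C : Set X) : Set X :=
  {x | Tendsto (fun k : ℕ => infDist (g^[k] x) C) atTop (𝓝 0)}

/-- The unstable set of a set `C`: points whose backward orbit converges to `C`. -/
def Wunstab (f : X ≃ₜ X) (C : Set X) : Set X :=
  {x | Tendsto (fun k : ℕ => infDist ((⇑f.symm)^[k] x) C) atTop (𝓝 0)}

/-- The `n`-th iterate of a homeomorphism, for `n : ℤ`. -/
def zIter (f : X ≃ₜ X) (n : ℤ) : X → X :=
  if 0 ≤ n then (⇑f)^[n.toNat] else (⇑f.symm)^[(-n).toNat]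

/-- Kato's property for the constant `m`: any subcontinuum of diameter greater than `c/2`
attains diameter greater than `c` within `m` iterates (forward or backward). -/
def KatoProperty (f : X ≃ₜ X) (c : ℝ) (m : ℕ) : Prop :=
  ∀ C : Set X, Subcontinuum C → c / 2 < diam C →
    ∃ n : ℤ, |n| ≤ (m : ℤ) ∧ c < diam (zIter f n '' C)

/-- The function `ρ(C) = α^{-N(C)}`, where `N(C)` is the least `|n|` with
`diam(fⁿ(C)) > c` (and `ρ(C) = 0` if no such `n` exists, e.g. for singletons). -/
noncomputable def rho (f : X ≃ₜ X) (c α : ℝ) (C : Set X) : ℝ :=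
  sSup {r : ℝ | ∃ n : ℤ, r = α ^ (-|n|) ∧ c < diam (zIter f n '' C)}

/-- The function `P(C_(p,q)) = inf Σ ρ(A_i)` over chains of subcontinua covering `C`
from `p` to `q`. -/
noncomputable def Pfun (f : X ≃ₜ X) (c α : ℝ) (p q : X) (C : Set X) : ℝ :=
  sInf {s : ℝ | ∃ (n : ℕ) (A : ℕ → Set X) (a : ℕ → X),
    1 ≤ n ∧ a 0 = p ∧ a n = q ∧
    (∀ i < n, Subcontinuum (A i) ∧ a i ∈ A i ∧ a (i + 1) ∈ A i) ∧
    C = ⋃ i ∈ Finset.range n, A i ∧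
    s = ∑ i ∈ Finset.range n, rho f c α (A i)}

/-- The function `D'(C_(p,q)) = max_{|i| ≤ n₀ - 1} P(f^i(C_(p,q)))/λ^{|i|}`. -/
noncomputable def Dprime (f : X ≃ₜ X) (c α lam : ℝ) (n₀ : ℕ) (p q : X) (C : Set X) : ℝ :=
  sSup {r : ℝ | ∃ i : ℤ, |i| ≤ (n₀ : ℤ) - 1 ∧
    r = Pfun f c α (zIter f i p) (zIter f i q) (zIter f i '' C) / lam ^ |i|}

theorem zIter_eq_zpow (f : X ≃ₜ X) (n : ℤ) : zIter f n = ⇑(f ^ n) := by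
  have coe_pow (g : X ≃ₜ X) (k : ℕ) : (⇑g)^[k] = ⇑(g ^ k) := by
    induction k with
    | zero => rfl
    | succ k ih => rw [Function.iterate_succ, ih, pow_succ]; rfl
  unfold zIter
  split_ifs with h
  · rw [coe_pow, ← zpow_natCast, Int.toNat_of_nonneg h]
  · rw [coe_pow, ← zpow_natCast, Int.toNat_of_nonneg (by lia)]
    change ⇑(f⁻¹ ^ (-n)) = _
    rw [inv_zpow', neg_neg]

theorem zIter_zero (f : X ≃ₜ X) : zIter f 0 = id := by
  rw [zIter_eq_zpow, zpow_zero]; rfl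

theorem zIter_one (f : X ≃ₜ X) : zIter f 1 = f := by
  rw [zIter_eq_zpow, zpow_one]

theorem zIter_neg_one (f : X ≃ₜ X) : zIter f (-1) = f.symm := by
  rw [zIter_eq_zpow, zpow_neg_one]; rfl

theorem zIter_add (f : X ≃ₜ X) (m n : ℤ) : zIter f (m + n) = zIter f m ∘ zIter f n := by
  simp only [zIter_eq_zpow, zpow_add]; rfl

theorem Subcontinuum.zIter_image {C : Set X} (hC : Subcontinuum C) (f : X ≃ₜ X) (n : ℤ) :
    Subcontinuum (zIter f n '' C) := by
  rw [zIter_eq_zpow]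
  exact ⟨hC.1.image (f ^ n).continuous, hC.2.image _ (f ^ n).continuous.continuousOn⟩

section WeightedSup

variable {a : ℤ → ℝ} {lam : ℝ}

theorem bddAbove_range_div_pow_abs (hlam : 1 < lam) (hnn : ∀ i, 0 ≤ a i) (hbd : ∀ i, a i ≤ 1) :
    BddAbove (range fun i : ℤ => a i / lam ^ |i|) := by
  refine ⟨1, ?_⟩
  rintro _ ⟨i, rfl⟩
  exact (div_le_self (hnn i) (one_le_zpow₀ hlam.le (abs_nonneg i))).trans (hbd i)

theorem le_iSup_div_pow_abs (hlam : 1 < lam) (hnn : ∀ i, 0 ≤ a i) (hbd : ∀ i, a i ≤ 1) :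
    a 0 ≤ ⨆ i : ℤ, a i / lam ^ |i| := by
  simpa using le_ciSup (bddAbove_range_div_pow_abs hlam hnn hbd) 0

theorem iSup_shift_le (hlam : 1 < lam) (hnn : ∀ i, 0 ≤ a i) (hbd : ∀ i, a i ≤ 1) {k : ℤ}
    (hk : |k| = 1) :
    ⨆ i : ℤ, a (i + k) / lam ^ |i| ≤ lam * ⨆ i : ℤ, a i / lam ^ |i| := by
  have h0 : 0 < lam := by linarith
  refine ciSup_le fun i => ?_
  calc a (i + k) / lam ^ |i|
      = lam * (a (i + k) / lam ^ (|i| + 1)) := by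
        rw [zpow_add_one₀ h0.ne']; field_simp
    _ ≤ lam * (a (i + k) / lam ^ |i + k|) := by
        have hp : 0 < lam ^ |i + k| := zpow_pos h0 _
        have hle : lam ^ |i + k| ≤ lam ^ (|i| + 1) :=
          zpow_le_zpow_right₀ hlam.le ((abs_add_le i k).trans (by rw [hk]))
        have := hnn (i + k)
        gcongr
    _ ≤ _ := by
        gcongr
        exact le_ciSup (bddAbove_range_div_pow_abs hlam hnn hbd) (i + k)

theorem mul_term_le_iSup_shift (hlam : 1 < lam) (hnn : ∀ i, 0 ≤ a i) (hbd : ∀ i, a i ≤ 1)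
    {i k : ℤ} (hik : |i - k| + 1 = |i|) :
    lam * (a i / lam ^ |i|) ≤ ⨆ j : ℤ, a (j + k) / lam ^ |j| := by
  have h0 : 0 < lam := by linarith
  have h := le_ciSup (bddAbove_range_div_pow_abs (a := fun j => a (j + k)) hlam
    (fun j => hnn _) (fun j => hbd _)) (i - k)
  refine le_of_eq_of_le ?_ h
  simp only [sub_add_cancel]
  rw [← hik, zpow_add_one₀ h0.ne']
  field_simp

theorem max_iSup_shift_eq (hlam : 1 < lam) (hnn : ∀ i, 0 ≤ a i) (hbd : ∀ i, a i ≤ 1)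
    (hgrow : lam * a 0 ≤ max (a 1) (a (-1))) :
    max (⨆ i : ℤ, a (i + 1) / lam ^ |i|) (⨆ i : ℤ, a (i + -1) / lam ^ |i|) =
      lam * ⨆ i : ℤ, a i / lam ^ |i| := by
  have h0 : 0 < lam := by linarith
  apply le_antisymm
  · exact max_le (iSup_shift_le hlam hnn hbd (by simp)) (iSup_shift_le hlam hnn hbd (by simp))
  · rw [Real.mul_iSup_of_nonneg h0.le]
    refine ciSup_le fun i => ?_
    rcases lt_trichotomy i 0 with hi | rfl | hi
    · exact le_max_of_le_right (mul_term_le_iSup_shift hlam hnn hbd (by grind))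
    · have h1 := le_iSup_div_pow_abs (a := fun j => a (j + 1)) hlam
        (fun j => hnn _) (fun j => hbd _)
      have h2 := le_iSup_div_pow_abs (a := fun j => a (j + -1)) hlam
        (fun j => hnn _) (fun j => hbd _)
      simpa using hgrow.trans (max_le_max (by simpa using h1) (by simpa using h2))
    · exact le_max_of_le_left (mul_term_le_iSup_shift hlam hnn hbd (by grind))

end WeightedSup

/-- If `D'` is bounded in `[0,1]` and expands by at least `λ` below the threshold `δ`,
then `D = sup_{i∈ℤ} D'(f^i(·))/λ^{|i|}` dominates `D'` and is exactly self-similar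
below the threshold `δ`. -/
theorem selfSimilar_of_sup
    [CompactSpace X]
    (f : X ≃ₜ X) (lam : ℝ) (hlam : 1 < lam)
    (D' D : X → X → Set X → ℝ)
    (hnn : ∀ (C : Set X) (p q : X), Subcontinuum C → p ∈ C → q ∈ C → 0 ≤ D' p q C)
    (hbd : ∀ (C : Set X) (p q : X), Subcontinuum C → p ∈ C → q ∈ C → D' p q C ≤ 1)
    (δ : ℝ) (hδ : 0 < δ)
    (hgrow : ∀ (C : Set X) (p q : X), Subcontinuum C → p ∈ C → q ∈ C → D' p q C ≤ δ →
      lam * D' p q C ≤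
        max (D' (f p) (f q) (⇑f '' C)) (D' (f.symm p) (f.symm q) (⇑f.symm '' C)))
    (hD : ∀ (p q : X) (C : Set X), D p q C =
      sSup {r : ℝ | ∃ i : ℤ,
        r = D' (zIter f i p) (zIter f i q) (zIter f i '' C) / lam ^ |i|}) :
    (∀ (C : Set X) (p q : X), Subcontinuum C → p ∈ C → q ∈ C → D' p q C ≤ D p q C) ∧
    (∀ (C : Set X) (p q : X), Subcontinuum C → p ∈ C → q ∈ C → D p q C ≤ δ →
      max (D (f p) (f q) (⇑f '' C)) (D (f.symm p) (f.symm q) (⇑f.symm '' C)) =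
        lam * D p q C) := by
  have hD_eq (p q : X) (C : Set X) : D p q C =
      ⨆ i : ℤ, D' (zIter f i p) (zIter f i q) (zIter f i '' C) / lam ^ |i| := by
    rw [hD, ← sSup_range]
    congr 1
    ext r
    exact exists_congr fun i => eq_comm
  have hD_shift (k : ℤ) (p q : X) (C : Set X) :
      D (zIter f k p) (zIter f k q) (zIter f k '' C) =
        ⨆ i : ℤ, D' (zIter f (i + k) p) (zIter f (i + k) q) (zIter f (i + k) '' C) /
          lam ^ |i| := by
    simp only [hD_eq, zIter_add, image_image, Function.comp_apply]
  have main (C : Set X) (p q : X) (hC : Subcontinuum C) (hp : p ∈ C) (hq : q ∈ C) :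
      D' p q C ≤ D p q C ∧ (D' p q C ≤ δ →
        max (D (f p) (f q) (⇑f '' C)) (D (f.symm p) (f.symm q) (⇑f.symm '' C)) =
          lam * D p q C) := by
    let a : ℤ → ℝ := fun i => D' (zIter f i p) (zIter f i q) (zIter f i '' C)
    have ha0 : a 0 = D' p q C := by simp [a, zIter_zero]
    have hann (i : ℤ) : 0 ≤ a i :=
      hnn _ _ _ (hC.zIter_image f i) (mem_image_of_mem _ hp) (mem_image_of_mem _ hq)
    have habd (i : ℤ) : a i ≤ 1 :=
      hbd _ _ _ (hC.zIter_image f i) (mem_image_of_mem _ hp) (mem_image_of_mem _ hq)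
    refine ⟨?_, fun hle => ?_⟩
    · rw [hD_eq, ← ha0]
      exact le_iSup_div_pow_abs hlam hann habd
    · have hagrow : lam * a 0 ≤ max (a 1) (a (-1)) := by
        simpa [a, zIter_zero, zIter_one, zIter_neg_one] using hgrow C p q hC hp hq hle
      have h1 := hD_shift 1 p q C
      have h2 := hD_shift (-1) p q C
      rw [zIter_one] at h1
      rw [zIter_neg_one] at h2
      rw [h1, h2, hD_eq p q C]
      exact max_iSup_shift_eq hlam hann habd hagrow
  exact ⟨fun C p q hC hp hq => (main C p q hC hp hq).1, fun C p q hC hp hq hle =>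
    (main C p q hC hp hq).2 ((main C p q hC hp hq).1.trans hle)⟩

end CwDyn
end

section
/- Let f be a homeomorphism of a compact metric space X and let D be a self-similar hyperbolic cw-metric for f with cw-expansiveness constant ξ>0 and expansion constant λ>1. If C_(p,q)∈E satisfies D(f(C_(p,q)))=λ·D(C_(p,q)), then for every integer k≥1 such that λ^{k−1}·D(C_(p,q))≤ξ one has D(f^k(C_(p,q)))=λ^k·D(C_(p,q)). -/
open Metric Set Filter Topology

namespace CwDyn

variable {X : Type*} [MetricSpace X]

theorem Subcontinuum.image {C : Set X} (hC : Subcontinuum C) {g : X → X} (hg : Continuous g) :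
    Subcontinuum (g '' C) :=
  ⟨hC.1.image hg, hC.2.image g hg.continuousOn⟩

/-- One step of expansion propagates to the next step, as long as the size stays below `ξ`. -/
theorem SelfSimilarWith.expand_succ {f : X ≃ₜ X} {D : X → X → Set X → ℝ}
    (hD : IsHypCwMetric f D) {ξ lam : ℝ} (hlam : 1 < lam) (hss : SelfSimilarWith f D ξ lam)
    {C : Set X} {p q : X} (hC : Subcontinuum C) (hp : p ∈ C) (hq : q ∈ C)
    (h : D (f p) (f q) (f '' C) = lam * D p q C) (hle : D (f p) (f q) (f '' C) ≤ ξ) :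
    D (f (f p)) (f (f q)) (f '' (f '' C)) = lam * D (f p) (f q) (f '' C) := by
  have hC1 := hC.image f.continuous
  have hp1 := mem_image_of_mem f hp
  have hq1 := mem_image_of_mem f hq
  have hmax := hss _ _ _ hC1 hp1 hq1 hle
  rw [f.symm_apply_apply, f.symm_apply_apply, Function.LeftInverse.image_image f.symm_apply_apply] at hmax
  have h0 := hD.nonneg C p q hC hp hq
  have h2 := hD.nonneg _ _ _ (hC1.image f.continuous) (mem_image_of_mem f hp1)
    (mem_image_of_mem f hq1)
  rcases h0.eq_or_lt with h0 | h0
  · rw [h, ← h0, mul_zero, mul_zero] at hmax ⊢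
    exact le_antisymm (hmax ▸ le_max_left _ _) h2
  · have hlt : D p q C < lam * D (f p) (f q) (f '' C) := by
      rw [h]
      nlinarith [mul_pos (sub_pos.2 hlam) h0]
    rcases max_choice (D (f (f p)) (f (f q)) (f '' (f '' C))) (D p q C) with hm | hm
    · exact hm.symm.trans hmax
    · exact absurd (hm.symm.trans hmax) hlt.ne

/-- If `D(f(C_(p,q))) = λ D(C_(p,q))`, then `D(f^k(C_(p,q))) = λ^k D(C_(p,q))` for every
`k ≥ 1` with `λ^{k-1} D(C_(p,q)) ≤ ξ`. -/
theorem selfSimilar_iterate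
    [CompactSpace X]
    (f : X ≃ₜ X) (D : X → X → Set X → ℝ) (hD : IsHypCwMetric f D)
    (ξ lam : ℝ) (hξ : 0 < ξ) (hlam : 1 < lam) (hss : SelfSimilarWith f D ξ lam)
    (C : Set X) (p q : X) (hC : Subcontinuum C) (hp : p ∈ C) (hq : q ∈ C)
    (h1 : D (f p) (f q) (⇑f '' C) = lam * D p q C) :
    ∀ k : ℕ, 1 ≤ k → lam ^ (k - 1) * D p q C ≤ ξ →
      D ((⇑f)^[k] p) ((⇑f)^[k] q) ((⇑f)^[k] '' C) = lam ^ k * D p q C := by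
  have h0 := hD.nonneg C p q hC hp hq
  have key : ∀ k : ℕ, lam ^ k * D p q C ≤ ξ →
      D (f^[k] p) (f^[k] q) (f^[k] '' C) = lam ^ k * D p q C ∧
      D (f (f^[k] p)) (f (f^[k] q)) (f '' (f^[k] '' C)) = lam * (lam ^ k * D p q C) := by
    intro k
    induction k with
    | zero => intro _; simpa using h1
    | succ k ih =>
      intro hle
      have hmono : lam ^ k * D p q C ≤ lam ^ (k + 1) * D p q C := by
        gcongr
        · exact hlam.le
        · exact k.le_succ
      obtain ⟨hk, hk1⟩ := ih (hmono.trans hle)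
      have hpow : lam ^ (k + 1) * D p q C = lam * (lam ^ k * D p q C) := by ring
      rw [hpow] at hle ⊢
      rw [Function.iterate_succ', image_comp, Function.comp_apply, Function.comp_apply]
      refine ⟨hk1, ?_⟩
      rw [← hk1]
      exact hss.expand_succ hD hlam (hC.image (f.continuous.iterate k))
        (mem_image_of_mem _ hp) (mem_image_of_mem _ hq) (by rw [hk1, hk]) (by rwa [hk1])
  intro k hk hle
  obtain ⟨k, rfl⟩ := Nat.exists_eq_add_of_le' hk
  rw [Nat.add_sub_cancel] at hle
  rw [Function.iterate_succ', image_comp, Function.comp_apply, Function.comp_apply,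
    (key k hle).2]
  ring

end CwDyn
end

section
/- Let f be a homeomorphism of a compact metric space X and let D be a self-similar hyperbolic cw-metric for f with cw-expansiveness constant ξ>0 and expansion constant λ>1. If C_(p,q)∈E satisfies D(fⁿ(C_(p,q)))≤ξ for every n≥0, then D(f^k(C_(p,q)))=λ^{−k}·D(C_(p,q)) for every k≥0. Dually, if D(f⁻ⁿ(C_(p,q)))≤ξ for every n≥0, then D(f⁻ᵏ(C_(p,q)))=λ^{−k}·D(C_(p,q)) for every k≥0. -/
open Metric Set Filter Topology

namespace CwDyn

variable {X : Type*} [MetricSpace X]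

/-- A bounded nonnegative sequence each of whose interior terms, multiplied by `lam > 1`, is the
maximum of its two neighbours decays exactly at rate `lam⁻¹`. -/
theorem eq_zpow_mul_of_max_neighbours {d : ℕ → ℝ} {B lam : ℝ} (hlam : 1 < lam)
    (hnonneg : ∀ n, 0 ≤ d n) (hB : ∀ n, d n ≤ B)
    (hmax : ∀ n, max (d (n + 2)) (d n) = lam * d (n + 1)) (k : ℕ) :
    d k = lam ^ (-(k : ℤ)) * d 0 := by
  have step : ∀ n, d n = lam * d (n + 1) := by
    intro n
    by_contra hne
    have hlt : d n < lam * d (n + 1) :=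
      lt_of_le_of_ne ((le_max_right _ _).trans_eq (hmax n)) hne
    have hpos : 0 < d (n + 1) := by
      have := (hnonneg n).trans_lt hlt
      exact pos_of_mul_pos_right this (by linarith)
    have grow : ∀ m, d (n + 1 + m) = lam ^ m * d (n + 1) ∧ d (n + m) < lam * d (n + 1 + m) := by
      intro m
      induction m with
      | zero => simpa using hlt
      | succ m ih =>
        obtain ⟨h1, h2⟩ := ih
        have h3 := hmax (n + m)
        have e1 : n + m + 1 = n + 1 + m := by omega
        have e2 : n + m + 2 = n + 1 + (m + 1) := by omega
        have e3 : n + (m + 1) = n + 1 + m := by omega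
        rw [e1, e2] at h3
        have h4 : d (n + 1 + (m + 1)) = lam * d (n + 1 + m) := by
          rcases max_choice (d (n + 1 + (m + 1))) (d (n + m)) with h | h
          · rw [← h3, h]
          · rw [h] at h3
            exact absurd h3 h2.ne
        have h5 : 0 < d (n + 1 + m) := by
          rw [h1]
          positivity
        refine ⟨by rw [h4, h1, pow_succ]; ring, ?_⟩
        rw [e3, h4]
        nlinarith [mul_pos h5 (sub_pos.2 hlam)]
    obtain ⟨m, hm⟩ := pow_unbounded_of_one_lt (B / d (n + 1)) hlam
    rw [div_lt_iff₀ hpos, ← (grow m).1] at hm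
    exact absurd (hB _) hm.not_ge
  have hne : lam ≠ 0 := by positivity
  induction k with
  | zero => simp
  | succ k ih =>
    have h : lam * d (k + 1) = lam * (lam ^ (-((k + 1 : ℕ) : ℤ)) * d 0) := by
      rw [← step k, ih, ← mul_assoc, ← zpow_one_add₀ hne]
      congr 2
      push_cast
      ring
    exact mul_left_cancel₀ hne h

theorem Subcontinuum.iterate_image {C : Set X} (hC : Subcontinuum C) (f : X ≃ₜ X) (n : ℕ) :
    Subcontinuum ((⇑f)^[n] '' C) :=
  ⟨hC.1.image (f.continuous.iterate n), hC.2.image _ (f.continuous.iterate n).continuousOn⟩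

theorem SelfSimilarWith.symm {f : X ≃ₜ X} {D : X → X → Set X → ℝ} {ξ lam : ℝ}
    (h : SelfSimilarWith f D ξ lam) : SelfSimilarWith f.symm D ξ lam := by
  intro C p q hC hp hq hle
  rw [max_comm]
  exact h C p q hC hp hq hle

theorem SelfSimilarWith.iterate_eq {f : X ≃ₜ X} {D : X → X → Set X → ℝ} {ξ lam : ℝ}
    (hss : SelfSimilarWith f D ξ lam)
    (hnonneg : ∀ (C : Set X) (p q : X), Subcontinuum C → p ∈ C → q ∈ C → 0 ≤ D p q C)
    (hlam : 1 < lam) {C : Set X} {p q : X} (hC : Subcontinuum C) (hp : p ∈ C) (hq : q ∈ C)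
    (hξ : ∀ n : ℕ, D ((⇑f)^[n] p) ((⇑f)^[n] q) ((⇑f)^[n] '' C) ≤ ξ) (k : ℕ) :
    D ((⇑f)^[k] p) ((⇑f)^[k] q) ((⇑f)^[k] '' C) = lam ^ (-(k : ℤ)) * D p q C := by
  have hmem : ∀ (n : ℕ) {x : X}, x ∈ C → (⇑f)^[n] x ∈ (⇑f)^[n] '' C :=
    fun n _ hx => mem_image_of_mem _ hx
  have key := eq_zpow_mul_of_max_neighbours
    (d := fun n => D ((⇑f)^[n] p) ((⇑f)^[n] q) ((⇑f)^[n] '' C)) hlam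
    (fun n => hnonneg _ _ _ (hC.iterate_image f n) (hmem n hp) (hmem n hq)) hξ ?_ k
  · simpa using key
  · intro n
    have h := hss _ _ _ (hC.iterate_image f (n + 1)) (hmem _ hp) (hmem _ hq) (hξ (n + 1))
    have hfwd : ∀ x, f ((⇑f)^[n + 1] x) = (⇑f)^[n + 2] x :=
      fun x => (Function.iterate_succ_apply' _ _ _).symm
    have hbwd : ∀ x, f.symm ((⇑f)^[n + 1] x) = (⇑f)^[n] x := fun x => by
      rw [Function.iterate_succ_apply', f.symm_apply_apply]
    simpa only [image_image, hfwd, hbwd] using h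

/-- Stable continua contract exactly at rate `λ⁻¹` under a self-similar hyperbolic
cw-metric, and dually for unstable continua. -/
theorem selfSimilar_contraction
    [CompactSpace X]
    (f : X ≃ₜ X) (D : X → X → Set X → ℝ) (hD : IsHypCwMetric f D)
    (ξ lam : ℝ) (hξ : 0 < ξ) (hlam : 1 < lam) (hss : SelfSimilarWith f D ξ lam)
    (C : Set X) (p q : X) (hC : Subcontinuum C) (hp : p ∈ C) (hq : q ∈ C) :
    ((∀ n : ℕ, D ((⇑f)^[n] p) ((⇑f)^[n] q) ((⇑f)^[n] '' C) ≤ ξ) →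
      ∀ k : ℕ, D ((⇑f)^[k] p) ((⇑f)^[k] q) ((⇑f)^[k] '' C) =
        lam ^ (-(k : ℤ)) * D p q C) ∧
    ((∀ n : ℕ, D ((⇑f.symm)^[n] p) ((⇑f.symm)^[n] q) ((⇑f.symm)^[n] '' C) ≤ ξ) →
      ∀ k : ℕ, D ((⇑f.symm)^[k] p) ((⇑f.symm)^[k] q) ((⇑f.symm)^[k] '' C) =
        lam ^ (-(k : ℤ)) * D p q C) := by
  exact ⟨hss.iterate_eq hD.nonneg hlam hC hp hq,
    hss.symm.iterate_eq hD.nonneg hlam hC hp hq⟩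

end CwDyn
end
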